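/- Let W be the Weyl group of type C_{n+1}, P = P_k (1 < k ≤ n+1), and let w ∈ W^{P_k} be odd-symplectic with w(1) = 1, corresponding under the standard bijection to λ ∈ Λ with λ_1 = 2n+1-k. Let O_1 = (2 < 3 < ⋯ < k < \overline{k+1}). Then λ* exists (i.e., λ_k ≥ 0) if and only if wO_1 is a minimal length representative in W^{odd}; and in that case wO_1 corresponds to the partition λ*, so in particular ℓ(wO_1) = ℓ(w) + ℓ(O_1). -/

import Mathlib

def bar (n : ℕ) (i : Fin (2*n+2)) : Fin (2*n+2) := ⟨2*n+1 - i, by have := i.isLt; omega⟩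

def IsSigned (n : ℕ) (w : Equiv.Perm (Fin (2*n+2))) : Prop :=
  ∀ i, w (bar n i) = bar n (w i)

def IsOddSymp (n : ℕ) (w : Equiv.Perm (Fin (2*n+2))) : Prop :=
  ∀ j : Fin (2*n+2), (j : ℕ) < n+1 → (w j : ℕ) ≠ 2*n+1

def sgen (n : ℕ) (i : Fin (n+1)) : Equiv.Perm (Fin (2*n+2)) :=
  if h : (i : ℕ) < n then
    (Equiv.swap ⟨i, by omega⟩ ⟨(i : ℕ)+1, by omega⟩) *
      (Equiv.swap ⟨2*n - i, by omega⟩ ⟨2*n+1 - i, by omega⟩)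
  else Equiv.swap ⟨n, by omega⟩ ⟨n+1, by omega⟩

noncomputable def len (n : ℕ) (w : Equiv.Perm (Fin (2*n+2))) : ℕ :=
  sInf {m | ∃ l : List (Fin (n+1)), l.length = m ∧ (l.map (sgen n)).prod = w}

def WP (n k : ℕ) : Subgroup (Equiv.Perm (Fin (2*n+2))) :=
  Subgroup.closure {x | ∃ i : Fin (n+1), (i : ℕ) ≠ k - 1 ∧ x = sgen n i}

noncomputable def IsMinRep (n k : ℕ) (w : Equiv.Perm (Fin (2*n+2))) : Prop :=
  ∀ p ∈ WP n k, len n w ≤ len n (w * p)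

noncomputable def cosetLen (n k : ℕ) (w : Equiv.Perm (Fin (2*n+2))) : ℕ :=
  sInf {m | ∃ p ∈ WP n k, len n (w * p) = m}

def s2t1 (n : ℕ) : Equiv.Perm (Fin (2*n+2)) := Equiv.swap ⟨0, by omega⟩ ⟨2*n+1, by omega⟩

def st1t2 (n : ℕ) : Equiv.Perm (Fin (2*n+2)) :=
  Equiv.swap ⟨0, by omega⟩ ⟨2*n, by omega⟩ * Equiv.swap ⟨1, by omega⟩ ⟨2*n+1, by omega⟩

/-- The `(n-k)`-strict partition associated to a minimal length representative in
`W^{P_k} ∩ W^{odd}`: `λ_j = 2n+2-k-w(j) + #{i<j : w(i)+w(j) > 2n+3}` (values 1-based). -/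
def partOf (n k : ℕ) (hk : k ≤ 2*n+2) (σ : Equiv.Perm (Fin (2*n+2))) (j : Fin k) : ℤ :=
  ((2*n+2 : ℤ) - k) - (((σ (Fin.castLE hk j) : ℕ) : ℤ) + 1) +
    (Finset.univ.filter (fun i : Fin k => i < j ∧
      ((σ (Fin.castLE hk i) : ℕ) + 1) + ((σ (Fin.castLE hk j) : ℕ) + 1) > 2*n+3)).card

/-- `λ* = (λ_2, λ_3, ..., λ_k, 0)`. -/
def starP (k : ℕ) (lam : Fin k → ℤ) (j : Fin k) : ℤ :=
  if h : (j : ℕ) + 1 < k then lam ⟨(j : ℕ)+1, h⟩ else 0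

/-- `λ** = (λ_1, λ_3, ..., λ_k, -1)`. -/
def dstarP (k : ℕ) (hk : 0 < k) (lam : Fin k → ℤ) (j : Fin k) : ℤ :=
  if (j : ℕ) = 0 then lam ⟨0, hk⟩
  else if h : (j : ℕ) + 1 < k then lam ⟨(j : ℕ)+1, h⟩ else -1

theorem bar_val (n : ℕ) (i : Fin (2*n+2)) : (bar n i : ℕ) = 2*n+1 - i := rfl

theorem bar_bar (n : ℕ) (i : Fin (2*n+2)) : bar n (bar n i) = i := by
  apply Fin.ext; have := i.isLt; simp only [bar_val]; omega

theorem sgen_val_lt (n : ℕ) (i : Fin (n+1)) (h : (i : ℕ) < n) (j : Fin (2*n+2)) :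
    (sgen n i j : ℕ) = if (j : ℕ) = i then (i : ℕ)+1 else if (j : ℕ) = i+1 then (i : ℕ)
      else if (j : ℕ) = 2*n - i then 2*n+1-i else if (j : ℕ) = 2*n+1-i then 2*n-i else (j : ℕ) := by
  have := j.isLt
  unfold sgen
  rw [dif_pos h]
  rw [Equiv.Perm.mul_apply, Equiv.swap_apply_def, Equiv.swap_apply_def]
  split_ifs <;> simp only [Fin.ext_iff] at * <;> omega

theorem sgen_val_eq (n : ℕ) (i : Fin (n+1)) (h : ¬ (i : ℕ) < n) (j : Fin (2*n+2)) :
    (sgen n i j : ℕ) = if (j : ℕ) = n then n+1 else if (j : ℕ) = n+1 then n else (j : ℕ) := by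
  unfold sgen
  rw [dif_neg h]
  simp only [Equiv.swap_apply_def, Fin.ext_iff]
  split_ifs <;> rfl

theorem sgen_signed (n : ℕ) (i : Fin (n+1)) : IsSigned n (sgen n i) := by
  intro j
  apply Fin.ext
  have := j.isLt
  by_cases h : (i : ℕ) < n
  · rw [bar_val, sgen_val_lt n i h, sgen_val_lt n i h, bar_val]
    split_ifs <;> omega
  · rw [bar_val, sgen_val_eq n i h, sgen_val_eq n i h, bar_val]
    split_ifs <;> omega

theorem sgen_sq (n : ℕ) (i : Fin (n+1)) : sgen n i * sgen n i = 1 := by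
  ext j
  have := j.isLt
  rw [Equiv.Perm.mul_apply, Equiv.Perm.one_apply]
  by_cases h : (i : ℕ) < n
  · rw [sgen_val_lt n i h, sgen_val_lt n i h]
    split_ifs <;> omega
  · rw [sgen_val_eq n i h, sgen_val_eq n i h]
    split_ifs <;> omega

theorem signed_one (n : ℕ) : IsSigned n 1 := fun _ => rfl

theorem signed_mul {n : ℕ} {u v : Equiv.Perm (Fin (2*n+2))} (hu : IsSigned n u)
    (hv : IsSigned n v) : IsSigned n (u * v) := by
  intro i; rw [Equiv.Perm.mul_apply, Equiv.Perm.mul_apply, hv, hu]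

theorem signed_inv {n : ℕ} {u : Equiv.Perm (Fin (2*n+2))} (hu : IsSigned n u) :
    IsSigned n u⁻¹ := by
  intro i
  rw [Equiv.Perm.inv_eq_iff_eq, hu]
  simp

/-- inversions of `w` among ordered pairs satisfying `S`. -/
def invS {m : ℕ} (S : Fin m → Fin m → Prop) [DecidableRel S] (w : Equiv.Perm (Fin m)) :
    Finset (Fin m × Fin m) :=
  Finset.univ.filter (fun p => S p.1 p.2 ∧ p.1 < p.2 ∧ w p.2 < w p.1)

theorem mem_invS {m : ℕ} (S : Fin m → Fin m → Prop) [DecidableRel S] (w : Equiv.Perm (Fin m))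
    (i j : Fin m) : (i, j) ∈ invS S w ↔ S i j ∧ i < j ∧ w j < w i := by
  simp [invS]

theorem invS_mul {m : ℕ} (S : Fin m → Fin m → Prop) [DecidableRel S]
    (hS : ∀ i j, S i j → S j i) (u v : Equiv.Perm (Fin m))
    (hv : ∀ i j, S (v i) (v j) ↔ S i j)
    (h : ∀ i j, i < j → v j < v i → u (v j) < u (v i)) :
    (invS S (u * v)).card = (invS S u).card + (invS S v).card := by
  classical
  have e : invS S (u * v) =
      (invS S u).image (fun p => (v⁻¹ p.1, v⁻¹ p.2)) ∪ invS S v := by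
    ext ⟨i, j⟩
    simp only [mem_invS, Finset.mem_union, Finset.mem_image, Equiv.Perm.mul_apply, Prod.mk.injEq, Prod.exists]
    constructor
    · rintro ⟨h1, h2, h3⟩
      rcases lt_trichotomy (v i) (v j) with hl | hl | hl
      · left
        exact ⟨v i, v j, ⟨(hv _ _).2 h1, hl, h3⟩, by simp, by simp⟩
      · exact absurd (v.injective hl) h2.ne
      · right; exact ⟨h1, h2, hl⟩
    · rintro (⟨a, b, ⟨h1, h2, h3⟩, rfl, rfl⟩ | ⟨h1, h2, h3⟩)
      · refine ⟨?_, ?_, by simpa using h3⟩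
        · rw [← hv]; simpa using h1
        · rcases lt_trichotomy (v⁻¹ a) (v⁻¹ b) with hl | hl | hl
          · exact hl
          · exact absurd (v⁻¹.injective hl) h2.ne
          · have := h _ _ hl (by simpa using h2)
            have h3' : u (v (v⁻¹ b)) < u (v (v⁻¹ a)) := by simpa using h3
            exact absurd this (not_lt.2 h3'.le)
      · exact ⟨h1, h2, h _ _ h2 h3⟩
  rw [e, Finset.card_union_of_disjoint, Finset.card_image_of_injective]
  · rintro ⟨a, b⟩ ⟨c, d⟩ hh
    simpa using hh
  · rw [Finset.disjoint_left]
    rintro ⟨i, j⟩ h1 h2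
    simp only [mem_invS, Finset.mem_image, Prod.mk.injEq, Prod.exists] at h1 h2
    obtain ⟨a, b, ⟨_, h3, _⟩, rfl, rfl⟩ := h1
    have h3' : v (v⁻¹ a) < v (v⁻¹ b) := by simpa using h3
    exact absurd h2.2.2 (not_lt.2 h3'.le)

def MM (n : ℕ) (w : Equiv.Perm (Fin (2*n+2))) : ℕ :=
  (invS (fun _ _ => True) w).card + (invS (fun i j => j = bar n i) w).card

theorem MM_mul {n : ℕ} {u v : Equiv.Perm (Fin (2*n+2))} (hv : IsSigned n v)
    (h : ∀ i j, i < j → v j < v i → u (v j) < u (v i)) : MM n (u * v) = MM n u + MM n v := by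
  unfold MM
  rw [invS_mul _ _ u v _ h, invS_mul _ _ u v _ h]
  · ring
  · rintro i j rfl; exact (bar_bar n i).symm
  · intro i j; rw [← hv, v.injective.eq_iff]
  · simp
  · simp

theorem MM_one (n : ℕ) : MM n 1 = 0 := by
  unfold MM
  have key : ∀ (S : Fin (2*n+2) → Fin (2*n+2) → Prop) [DecidableRel S], (invS S 1).card = 0 := by
    intro S _
    rw [Finset.card_eq_zero, Finset.eq_empty_iff_forall_notMem]
    rintro ⟨i, j⟩ h
    rw [mem_invS] at h
    exact absurd h.2.1 (not_lt.2 (le_of_lt h.2.2))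
  rw [key, key]

theorem MM_sgen (n : ℕ) (i : Fin (n+1)) : MM n (sgen n i) = 2 := by
  unfold MM
  have hi := i.isLt
  by_cases h : (i : ℕ) < n
  · have e1 : invS (fun _ _ => True) (sgen n i) =
      {((⟨i, by omega⟩ : Fin (2*n+2)), (⟨i+1, by omega⟩ : Fin (2*n+2))),
       ((⟨2*n-i, by omega⟩ : Fin (2*n+2)), (⟨2*n+1-i, by omega⟩ : Fin (2*n+2)))} := by
      ext ⟨a, b⟩
      have := a.isLt
      have := b.isLt
      simp only [mem_invS, true_and, Finset.mem_insert,
        Finset.mem_singleton, Prod.mk.injEq, Fin.lt_def, Fin.ext_iff, sgen_val_lt n i h]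
      split_ifs <;> omega
    have e2 : invS (fun i j => j = bar n i) (sgen n i) = ∅ := by
      rw [Finset.eq_empty_iff_forall_notMem]
      rintro ⟨a, b⟩
      have := a.isLt
      have := b.isLt
      simp only [mem_invS, true_and, Fin.lt_def, Fin.ext_iff,
        sgen_val_lt n i h, bar_val]
      split_ifs <;> omega
    rw [e1, e2, Finset.card_pair]
    · rfl
    · simp only [ne_eq, Prod.mk.injEq, Fin.mk.injEq]; omega
  · have e1 : invS (fun _ _ => True) (sgen n i) =
      {((⟨n, by omega⟩ : Fin (2*n+2)), (⟨n+1, by omega⟩ : Fin (2*n+2)))} := by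
      ext ⟨a, b⟩
      have := a.isLt
      have := b.isLt
      simp only [mem_invS, true_and,
        Finset.mem_singleton, Prod.mk.injEq, Fin.lt_def, Fin.ext_iff, sgen_val_eq n i h]
      split_ifs <;> omega
    have e2 : invS (fun i j => j = bar n i) (sgen n i) =
      {((⟨n, by omega⟩ : Fin (2*n+2)), (⟨n+1, by omega⟩ : Fin (2*n+2)))} := by
      ext ⟨a, b⟩
      have := a.isLt
      have := b.isLt
      simp only [mem_invS, true_and, bar_val,
        Finset.mem_singleton, Prod.mk.injEq, Fin.lt_def, Fin.ext_iff, sgen_val_eq n i h]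
      split_ifs <;> omega
    rw [e1, e2, Finset.card_singleton]

/-- ascent at `i` -/
def Asc (n : ℕ) (w : Equiv.Perm (Fin (2*n+2))) (i : Fin (n+1)) : Prop :=
  w ⟨i, by omega⟩ < w ⟨i+1, by omega⟩

theorem MM_asc {n : ℕ} {w : Equiv.Perm (Fin (2*n+2))} (hw : IsSigned n w) (i : Fin (n+1))
    (ha : Asc n w i) : MM n (w * sgen n i) = MM n w + 2 := by
  rw [MM_mul (sgen_signed n i), MM_sgen]
  intro a b hab hs
  have := a.isLt
  have := b.isLt
  by_cases h : (i : ℕ) < n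
  · have ha' : w ⟨2*n-i, by omega⟩ < w ⟨2*n+1-i, by omega⟩ := by
      have e1 : (⟨2*n-i, by omega⟩ : Fin (2*n+2)) = bar n ⟨i+1, by omega⟩ := by
        apply Fin.ext; simp only [bar_val]; omega
      have e2 : (⟨2*n+1-i, by omega⟩ : Fin (2*n+2)) = bar n ⟨i, by omega⟩ := by
        apply Fin.ext; simp only [bar_val]
      rw [e1, e2, hw, hw, Fin.lt_def, bar_val, bar_val]
      unfold Asc at ha
      rw [Fin.lt_def] at ha
      omega
    have key : ((sgen n i a : ℕ) = i+1 ∧ (sgen n i b : ℕ) = i) ∨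
        ((sgen n i a : ℕ) = 2*n+1-i ∧ (sgen n i b : ℕ) = 2*n-i) := by
      rw [Fin.lt_def] at hab hs
      rw [sgen_val_lt n i h, sgen_val_lt n i h] at hs ⊢
      split_ifs at hs ⊢ <;> omega
    rcases key with ⟨k1, k2⟩ | ⟨k1, k2⟩
    · have e1 : sgen n i a = ⟨i+1, by omega⟩ := Fin.ext k1
      have e2 : sgen n i b = ⟨i, by omega⟩ := Fin.ext k2
      rw [e1, e2]; exact ha
    · have e1 : sgen n i a = ⟨2*n+1-i, by omega⟩ := Fin.ext k1
      have e2 : sgen n i b = ⟨2*n-i, by omega⟩ := Fin.ext k2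
      rw [e1, e2]; exact ha'
  · have key : ((sgen n i a : ℕ) = i+1 ∧ (sgen n i b : ℕ) = i) := by
      rw [Fin.lt_def] at hab hs
      rw [sgen_val_eq n i h, sgen_val_eq n i h] at hs ⊢
      split_ifs at hs ⊢ <;> omega
    have e1 : sgen n i a = ⟨i+1, by omega⟩ := Fin.ext key.1
    have e2 : sgen n i b = ⟨i, by omega⟩ := Fin.ext key.2
    rw [e1, e2]; exact ha

theorem sgen_at (n : ℕ) (i : Fin (n+1)) : sgen n i ⟨i, by omega⟩ = ⟨i+1, by omega⟩ ∧
    sgen n i ⟨i+1, by omega⟩ = ⟨i, by omega⟩ := by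
  have := i.isLt
  constructor <;> apply Fin.ext <;> by_cases h : (i : ℕ) < n
  · rw [sgen_val_lt n i h]; simp
  · rw [sgen_val_eq n i h]; split_ifs <;> simp only [] at * <;> omega
  · rw [sgen_val_lt n i h]; simp
  · rw [sgen_val_eq n i h]; split_ifs <;> simp only [] at * <;> omega

theorem MM_desc {n : ℕ} {w : Equiv.Perm (Fin (2*n+2))} (hw : IsSigned n w) (i : Fin (n+1))
    (ha : ¬ Asc n w i) : MM n w = MM n (w * sgen n i) + 2 := by
  have h2 : Asc n (w * sgen n i) i := by
    unfold Asc at *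
    rw [Equiv.Perm.mul_apply, Equiv.Perm.mul_apply, (sgen_at n i).1, (sgen_at n i).2]
    rcases lt_or_eq_of_le (not_lt.1 ha) with h | h
    · exact h
    · have := congrArg Fin.val (w.injective h); simp at this
  have := MM_asc (signed_mul hw (sgen_signed n i)) i h2
  rwa [mul_assoc, sgen_sq, mul_one] at this

theorem signed_prod (n : ℕ) (l : List (Fin (n+1))) : IsSigned n (l.map (sgen n)).prod := by
  induction l with
  | nil => exact signed_one n
  | cons a l ih => rw [List.map_cons, List.prod_cons]; exact signed_mul (sgen_signed n a) ih

theorem MM_prod_le (n : ℕ) (l : List (Fin (n+1))) : MM n (l.map (sgen n)).prod ≤ 2 * l.length := by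
  induction l using List.reverseRecOn with
  | nil => simp [MM_one]
  | append_singleton l a ih =>
    rw [List.map_append, List.prod_append, List.length_append]
    simp only [List.map_cons, List.map_nil, List.prod_cons, List.prod_nil, mul_one,
      List.length_cons, List.length_nil]
    by_cases h : Asc n (l.map (sgen n)).prod a
    · rw [MM_asc (signed_prod n l) a h]; omega
    · have := MM_desc (signed_prod n l) a h; omega

theorem strictMono_perm {m : ℕ} (w : Equiv.Perm (Fin m)) (h : StrictMono w) : w = 1 := by
  have : (StrictMono.orderIsoOfSurjective w h w.surjective) = OrderIso.refl _ :=
    Subsingleton.elim _ _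
  ext i
  have := congrArg (fun e => e i) this
  simpa using congrArg Fin.val this

/-- nat-valued version of a permutation. -/
def FF (n : ℕ) (w : Equiv.Perm (Fin (2*n+2))) (i : ℕ) : ℕ :=
  if h : i < 2*n+2 then (w ⟨i, h⟩ : ℕ) else i

theorem FF_lt {n : ℕ} (w : Equiv.Perm (Fin (2*n+2))) {i : ℕ} (h : i < 2*n+2) :
    FF n w i < 2*n+2 := by
  unfold FF; rw [dif_pos h]; exact (w ⟨i, h⟩).isLt

theorem FF_eq {n : ℕ} (w : Equiv.Perm (Fin (2*n+2))) (i : Fin (2*n+2)) :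
    (w i : ℕ) = FF n w i := by
  unfold FF; rw [dif_pos i.isLt]

theorem FF_inj {n : ℕ} (w : Equiv.Perm (Fin (2*n+2))) {i j : ℕ} (h : i < 2*n+2) (h' : j < 2*n+2)
    (e : FF n w i = FF n w j) : i = j := by
  unfold FF at e; rw [dif_pos h, dif_pos h'] at e
  simpa using w.injective (Fin.ext e)

theorem FF_surj {n : ℕ} (w : Equiv.Perm (Fin (2*n+2))) {x : ℕ} (h : x < 2*n+2) :
    ∃ m, m < 2*n+2 ∧ FF n w m = x := by
  obtain ⟨m, hm⟩ := w.surjective ⟨x, h⟩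
  exact ⟨m, m.isLt, by rw [← FF_eq, hm]⟩

theorem FF_bar {n : ℕ} {w : Equiv.Perm (Fin (2*n+2))} (hw : IsSigned n w) {i : ℕ}
    (h : i < 2*n+2) : FF n w (2*n+1-i) = 2*n+1 - FF n w i := by
  have := congrArg Fin.val (hw ⟨i, h⟩)
  rw [bar_val, FF_eq, FF_eq, bar_val] at this
  exact this

theorem FF_mul {n : ℕ} (u v : Equiv.Perm (Fin (2*n+2))) {i : ℕ}
    (h : i < 2*n+2) : FF n (u * v) i = FF n u (FF n v i) := by
  rw [show i = ((⟨i, h⟩ : Fin (2*n+2)) : ℕ) from rfl, ← FF_eq, ← FF_eq, ← FF_eq]; rfl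

theorem mono_of_step {f : ℕ → ℕ} {a b : ℕ} (h : ∀ i, a ≤ i → i < b → f i < f (i+1)) :
    ∀ j i, a ≤ i → i < j → j ≤ b → f i < f j := by
  intro j
  induction j with
  | zero => intro i _ h1; omega
  | succ j ih =>
    intro i h1 h2 h3
    have hs := h j (by omega) (by omega)
    rcases Nat.lt_or_ge i j with h4 | h4
    · exact (ih i h1 h4 (by omega)).trans hs
    · have : i = j := by omega
      rw [this]; exact hs

theorem mono_mid {n k : ℕ} (hkn : k ≤ n) {w : Equiv.Perm (Fin (2*n+2))} (hw : IsSigned n w)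
    (h : ∀ i, k ≤ i → i ≤ n → FF n w i < FF n w (i+1)) :
    ∀ j i, k ≤ i → i < j → j ≤ 2*n+1-k → FF n w i < FF n w j := by
  apply mono_of_step
  intro i h1 h2
  by_cases h3 : i ≤ n
  · exact h i h1 h3
  · have h4 := h (2*n - i) (by omega) (by omega)
    have e1 := FF_bar hw (i := i) (by omega)
    have e2 := FF_bar hw (i := i+1) (by omega)
    have := FF_lt w (i := i) (by omega)
    have := FF_lt w (i := i+1) (by omega)
    rw [show 2*n+1-(i+1) = 2*n-i by omega] at e2
    rw [show 2*n-i+1 = 2*n+1-i by omega] at h4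
    omega

theorem asc_iff {n : ℕ} (w : Equiv.Perm (Fin (2*n+2))) (i : Fin (n+1)) :
    Asc n w i ↔ FF n w i < FF n w (i+1) := by
  unfold Asc; rw [Fin.lt_def, FF_eq, FF_eq]

theorem eq_one_of_asc {n : ℕ} {w : Equiv.Perm (Fin (2*n+2))} (hw : IsSigned n w)
    (h : ∀ i, Asc n w i) : w = 1 := by
  apply strictMono_perm
  intro i j hij
  rw [Fin.lt_def, FF_eq, FF_eq]
  refine mono_mid (k := 0) (by omega) hw ?_ _ _ (by omega) hij (by omega)
  intro i _ hi
  exact (asc_iff w ⟨i, by omega⟩).1 (h _)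

theorem exists_word (n : ℕ) : ∀ (N : ℕ) (w : Equiv.Perm (Fin (2*n+2))), IsSigned n w → MM n w ≤ N →
    ∃ l : List (Fin (n+1)), 2 * l.length = MM n w ∧ (l.map (sgen n)).prod = w := by
  intro N
  induction N with
  | zero =>
    intro w hw h
    refine ⟨[], by simp; omega, ?_⟩
    have : w = 1 := by
      apply eq_one_of_asc hw
      intro i
      by_contra hc
      have := MM_desc hw i hc
      omega
    rw [this]; rfl
  | succ N ih =>
    intro w hw h
    by_cases hall : ∀ i, Asc n w i
    · have := eq_one_of_asc hw hall
      subst this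
      exact ⟨[], by simp [MM_one], rfl⟩
    · push Not at hall
      obtain ⟨i, hi⟩ := hall
      have hd := MM_desc hw i hi
      obtain ⟨l, hl1, hl2⟩ := ih (w * sgen n i) (signed_mul hw (sgen_signed n i)) (by omega)
      refine ⟨l ++ [i], by simp; omega, ?_⟩
      simp [hl2, mul_assoc, sgen_sq]

theorem two_len {n : ℕ} {w : Equiv.Perm (Fin (2*n+2))} (hw : IsSigned n w) :
    2 * len n w = MM n w := by
  obtain ⟨l, h1, h2⟩ := exists_word n _ w hw le_rfl
  have hle : len n w ≤ l.length := Nat.sInf_le ⟨l, rfl, h2⟩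
  have hne : {m | ∃ l : List (Fin (n+1)), l.length = m ∧ (l.map (sgen n)).prod = w}.Nonempty :=
    ⟨_, l, rfl, h2⟩
  obtain ⟨l', h3, h4⟩ := Nat.sInf_mem hne
  have := MM_prod_le n l'
  rw [h4, h3] at this
  change MM n w ≤ 2 * len n w at this
  omega

def Sorted' (n k : ℕ) (w : Equiv.Perm (Fin (2*n+2))) : Prop :=
  ∀ i, i ≤ n → i + 1 ≠ k → FF n w i < FF n w (i+1)

theorem sorted_of_minRep {n k : ℕ} (hk : 1 ≤ k) {w : Equiv.Perm (Fin (2*n+2))}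
    (hw : IsSigned n w) (h : IsMinRep n k w) : Sorted' n k w := by
  intro i hi hik
  have := (asc_iff w ⟨i, by omega⟩)
  refine this.1 ?_
  by_contra hc
  have h1 := MM_desc hw _ hc
  have h2 := h (sgen n ⟨i, by omega⟩) (Subgroup.subset_closure ⟨_, by simp; omega, rfl⟩)
  rw [← two_len hw, ← two_len (signed_mul hw (sgen_signed n _))] at h1
  omega

theorem WP_prop {n k : ℕ} (hk : 1 ≤ k) (hkn : k ≤ n) {p : Equiv.Perm (Fin (2*n+2))} (hp : p ∈ WP n k) :
    IsSigned n p ∧ ∀ i, (p i : ℕ) < k ↔ (i : ℕ) < k := by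
  unfold WP at hp
  induction hp using Subgroup.closure_induction with
  | mem x hx =>
    obtain ⟨i, hi, rfl⟩ := hx
    refine ⟨sgen_signed n i, fun j => ?_⟩
    have := i.isLt
    have := j.isLt
    by_cases h : (i : ℕ) < n
    · rw [sgen_val_lt n i h]; split_ifs <;> omega
    · rw [sgen_val_eq n i h]; split_ifs <;> omega
  | one => exact ⟨signed_one n, fun _ => Iff.rfl⟩
  | mul x y _ _ hx hy =>
    refine ⟨signed_mul hx.1 hy.1, fun j => ?_⟩
    rw [Equiv.Perm.mul_apply, hx.2, hy.2]
  | inv x _ hx =>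
    refine ⟨signed_inv hx.1, fun j => ?_⟩
    rw [← hx.2]; simp

theorem sorted_unique {n k : ℕ} (hk : 1 ≤ k) (hkn : k ≤ n) {w p : Equiv.Perm (Fin (2*n+2))}
    (hw : IsSigned n w) (hp : p ∈ WP n k) (h1 : Sorted' n k w) (h2 : Sorted' n k (w * p)) :
    p = 1 := by
  obtain ⟨hps, hpk⟩ := WP_prop hk hkn hp
  have hpk' : ∀ i, i < 2*n+2 → (FF n p i < k ↔ i < k) := by
    intro i hi
    have := hpk ⟨i, hi⟩
    rwa [FF_eq] at this
  have A1 := mono_of_step (f := FF n w) (a := 0) (b := k-1)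
    (fun i _ _ => h1 i (by omega) (by omega))
  have B1 := mono_mid hkn hw (fun i _ _ => h1 i (by omega) (by omega))
  have A2 := mono_of_step (f := FF n (w*p)) (a := 0) (b := k-1)
    (fun i _ _ => h2 i (by omega) (by omega))
  have B2 := mono_mid hkn (signed_mul hw hps) (fun i _ _ => h2 i (by omega) (by omega))
  apply eq_one_of_asc hps
  intro i
  have hi := i.isLt
  rw [asc_iff]
  have c1 := hpk' i (by omega)
  have c2 := hpk' (i+1) (by omega)
  have d1 := hpk' (2*n+1-i) (by omega)
  have d2 := hpk' (2*n+1-(i+1)) (by omega)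
  rw [FF_bar hps (by omega)] at d1 d2
  have l1 := FF_lt p (i := i) (by omega)
  have l2 := FF_lt p (i := i+1) (by omega)
  by_contra hc
  have hne : FF n p i ≠ FF n p (i+1) := fun e => by
    have := FF_inj p (by omega) (by omega) e; omega
  rcases lt_trichotomy ((i : ℕ) + 1) k with h | h | h
  · have t := A2 (i+1) i (by omega) (by omega) (by omega)
    rw [FF_mul _ _ (by omega), FF_mul _ _ (by omega)] at t
    have := A1 (FF n p i) (FF n p (i+1)) (by omega) (by omega) (by omega)
    omega
  · omega
  · have t := B2 (i+1) i (by omega) (by omega) (by omega)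
    rw [FF_mul _ _ (by omega), FF_mul _ _ (by omega)] at t
    have := B1 (FF n p i) (FF n p (i+1)) (by omega) (by omega) (by omega)
    omega

theorem minRep_of_sorted {n k : ℕ} (hk : 1 ≤ k) (hkn : k ≤ n) {w : Equiv.Perm (Fin (2*n+2))}
    (hw : IsSigned n w) (h : Sorted' n k w) : IsMinRep n k w := by
  classical
  have hne : {m | ∃ p ∈ WP n k, len n (w * p) = m}.Nonempty := ⟨_, 1, one_mem _, rfl⟩
  obtain ⟨p, hp, hpl⟩ := Nat.sInf_mem hne
  have hmin : ∀ q ∈ WP n k, len n (w * p) ≤ len n (w * q) := by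
    intro q hq
    rw [hpl]; exact Nat.sInf_le ⟨q, hq, rfl⟩
  have hm : IsMinRep n k (w * p) := by
    intro q hq
    rw [mul_assoc]; exact hmin _ (mul_mem hp hq)
  have hs := sorted_of_minRep hk (signed_mul hw (WP_prop hk hkn hp).1) hm
  have := sorted_unique hk hkn hw hp h hs
  rwa [this, mul_one] at hm

theorem O1_val {n k : ℕ} (hk : 1 ≤ k) (hkn : k ≤ n) {O1 : Equiv.Perm (Fin (2*n+2))}
    (hs : IsSigned n O1) (h : Sorted' n k O1)
    (ha : ∀ j, j + 1 < k → FF n O1 j = j + 1) (hb : FF n O1 (k-1) = 2*n+1-k) :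
    FF n O1 k = 0 ∧ ∀ j, k < j → j ≤ n → FF n O1 j = j := by
  have B := mono_mid hkn hs (fun i _ _ => h i (by omega) (by omega))
  have hlow : ∀ j, k ≤ j → j ≤ n → FF n O1 j ≤ n := by
    intro j h1 h2
    have := B (2*n+1-j) j h1 (by omega) (by omega)
    rw [FF_bar hs (by omega)] at this
    omega
  have h0 : FF n O1 k = 0 := by
    obtain ⟨m, hm, hm0⟩ := FF_surj O1 (x := 0) (by omega)
    rcases Nat.lt_trichotomy m k with h1 | h1 | h1
    · rcases Nat.lt_or_ge (m+1) k with h2 | h2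
      · have := ha m h2; omega
      · have : m = k-1 := by omega
        rw [this] at hm0; omega
    · rw [← h1]; exact hm0
    · rcases Nat.lt_or_ge (2*n+1-k) m with h3 | h3
      · have e := FF_bar hs hm
        rcases Nat.lt_or_ge (2*n+1-m+1) k with h2 | h2
        · have := ha _ h2; omega
        · have : 2*n+1-m = k-1 := by omega
          rw [this] at e; omega
      · have := B m k (by omega) h1 h3
        omega
  refine ⟨h0, ?_⟩
  have hge : ∀ d, k + 1 + d ≤ n → k + 1 + d ≤ FF n O1 (k+1+d) := by
    intro d
    induction d with
    | zero =>
      intro hd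
      by_contra hc
      have hpos := B (k+1) k (by omega) (by omega) (by omega)
      simp only [Nat.add_zero] at hc
      rcases Nat.lt_or_ge (FF n O1 (k+1)) k with h1 | h1
      · have := ha (FF n O1 (k+1) - 1) (by omega)
        have := FF_inj O1 (i := FF n O1 (k+1) - 1) (j := k+1) (by omega) (by omega) (by omega)
        omega
      · have e := FF_bar hs (i := k-1) (by omega)
        rw [hb] at e
        have := FF_inj O1 (i := 2*n+1-(k-1)) (j := k+1) (by omega) (by omega) (by omega)
        omega
    | succ d ih =>
      intro hd
      have := ih (by omega)
      have := B (k+1+(d+1)) (k+1+d) (by omega) (by omega) (by omega)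
      omega
  have hle : ∀ d, k + 1 + d ≤ n → FF n O1 (n-d) ≤ n-d := by
    intro d
    induction d with
    | zero => intro hd; exact hlow n (by omega) le_rfl
    | succ d ih =>
      intro hd
      have := ih (by omega)
      have := B (n-d) (n-(d+1)) (by omega) (by omega) (by omega)
      omega
  intro j h1 h2
  have p1 := hge (j-(k+1)) (by omega)
  have p2 := hle (n-j) (by omega)
  rw [show k+1+(j-(k+1)) = j by omega] at p1
  rw [show n-(n-j) = j by omega] at p2
  omega

theorem partOf_eq {n k : ℕ} (hk : k ≤ 2*n+2) (σ : Equiv.Perm (Fin (2*n+2))) (j : Fin k) :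
    partOf n k hk σ j = (2*n+1 : ℤ) - k - FF n σ j +
      (∑ i ∈ Finset.range j, if 2*n+2 ≤ FF n σ i + FF n σ j then 1 else 0 : ℕ) := by
  unfold partOf
  have e : (Finset.univ.filter (fun i : Fin k => i < j ∧
      ((σ (Fin.castLE hk i) : ℕ) + 1) + ((σ (Fin.castLE hk j) : ℕ) + 1) > 2*n+3)).card =
      ∑ i ∈ Finset.range j, if 2*n+2 ≤ FF n σ i + FF n σ j then 1 else 0 := by
    rw [← Finset.card_filter]
    refine Finset.card_bij (fun (i : Fin k) _ => (i : ℕ)) ?_ ?_ ?_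
    · intro a ha
      simp only [FF_eq, Fin.val_castLE, Finset.mem_filter, Finset.mem_univ, true_and,
        Finset.mem_range, Fin.lt_def] at ha ⊢
      omega
    · intro a _ b _ hab; exact Fin.ext hab
    · intro b hb
      simp only [Finset.mem_filter, Finset.mem_range] at hb
      refine ⟨⟨b, by omega⟩, ?_, rfl⟩
      simp only [FF_eq, Fin.val_castLE, Finset.mem_filter, Finset.mem_univ, true_and, Fin.lt_def]
      omega
  rw [e, FF_eq]
  simp only [Fin.val_castLE]
  ring

theorem count_low {n k : ℕ} (hk : 1 ≤ k) (hkn : k ≤ n) {w : Equiv.Perm (Fin (2*n+2))}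
    (hw : IsSigned n w) (h : Sorted' n k w) (t : ℕ) (h1 : t ≤ FF n w k)
    (h2 : t + FF n w (k-1) ≤ 2*n+1) :
    (∑ i ∈ Finset.range k, if FF n w i < t then 1 else 0) = t := by
  have A := mono_of_step (f := FF n w) (a := 0) (b := k-1)
    (fun i _ _ => h i (by omega) (by omega))
  have B := mono_mid hkn hw (fun i _ _ => h i (by omega) (by omega))
  rw [← Finset.card_filter]
  have e : ((Finset.range k).filter (fun i => FF n w i < t)).image (FF n w) = Finset.range t := by
    ext x
    simp only [Finset.mem_image, Finset.mem_filter, Finset.mem_range]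
    constructor
    · rintro ⟨i, ⟨_, hi⟩, rfl⟩; exact hi
    · intro hx
      obtain ⟨m, hm, hmx⟩ := FF_surj w (x := x) (by omega)
      refine ⟨m, ⟨?_, by omega⟩, hmx⟩
      by_contra hc
      rcases Nat.lt_or_ge (2*n+1-k) m with h3 | h3
      · have e := FF_bar hw hm
        rcases Nat.lt_or_ge (2*n+1-m) (k-1) with h4 | h4
        · have := A (k-1) (2*n+1-m) (by omega) h4 le_rfl
          omega
        · rw [show 2*n+1-m = k-1 by omega] at e
          omega
      · rcases Nat.lt_or_ge k m with h4 | h4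
        · have := B m k le_rfl h4 h3
          omega
        · rw [show m = k by omega] at hmx
          omega
  have hc := congrArg Finset.card e
  rw [Finset.card_range, Finset.card_image_of_injOn] at hc
  · exact hc
  intro i hi j hj hij
  simp only [Finset.coe_filter, Finset.mem_range, Set.mem_ofPred_eq] at hi hj
  exact FF_inj w (by omega) (by omega) hij

theorem part_iff {n k : ℕ} (hk : 1 ≤ k) (hkn : k ≤ n) {w : Equiv.Perm (Fin (2*n+2))}
    (hw : IsSigned n w) (h : Sorted' n k w) (hle : k ≤ 2*n+2) (hlt : k - 1 < k) :
    (0 : ℤ) ≤ partOf n k hle w ⟨k-1, hlt⟩ ↔ FF n w (k-1) + FF n w k < 2*n+1 := by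
  rw [partOf_eq]
  simp only []
  have hv := FF_lt w (i := k-1) (by omega)
  have B := mono_mid hkn hw (fun i _ _ => h i (by omega) (by omega))
  have hne : ∀ i, i < 2*n+2 → i + (k-1) ≠ 2*n+1 → FF n w i + FF n w (k-1) ≠ 2*n+1 := by
    intro i hi hi2 e
    have e2 := FF_bar hw (i := k-1) (by omega)
    have := FF_inj w (i := i) (j := 2*n+1-(k-1)) hi (by omega) (by omega)
    omega
  have hsum : (∑ i ∈ Finset.range (k-1), if 2*n+2 ≤ FF n w i + FF n w (k-1) then 1 else 0) +
      (∑ i ∈ Finset.range (k-1), if FF n w i < 2*n+1 - FF n w (k-1) then 1 else 0) = k-1 := by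
    rw [← Finset.sum_add_distrib]
    rw [Finset.sum_congr rfl (g := fun _ => 1)]
    · simp
    · intro i hi
      rw [Finset.mem_range] at hi
      have := hne i (by omega) (by omega)
      split_ifs <;> omega
  have hak : FF n w k ≤ n := by
    have := B (2*n+1-k) k (by omega) (by omega) (by omega)
    rw [FF_bar hw (by omega)] at this
    omega
  constructor
  · intro h0
    by_contra hc
    have := hne k (by omega) (by omega)
    have hcnt := count_low hk hkn hw h (2*n+1 - FF n w (k-1)) (by omega) (by omega)
    rw [show Finset.range k = Finset.range (k-1+1) by congr 1; omega, Finset.sum_range_succ,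
      if_neg (by omega)] at hcnt
    omega
  · intro hlt
    have hcnt : (∑ i ∈ Finset.range (k-1), if FF n w i < 2*n+1 - FF n w (k-1) then 1 else 0) ≤
        2*n+1-FF n w (k-1) - 1 := by
      rw [← Finset.card_filter]
      have : ((Finset.range (2*n+1-FF n w (k-1))).erase (FF n w k)).card =
        2*n+1-FF n w (k-1) - 1 := by
        rw [Finset.card_erase_of_mem (by rw [Finset.mem_range]; omega), Finset.card_range]
      rw [← this]
      apply Finset.card_le_card_of_injOn (FF n w)
      · intro i hi
        simp only [Finset.coe_filter, Finset.mem_range, Set.mem_ofPred_eq] at hi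
        simp only [Finset.coe_erase, Finset.coe_range, Set.mem_sdiff, Set.mem_Iio,
          Set.mem_singleton_iff]
        refine ⟨hi.2, fun e => ?_⟩
        have := FF_inj w (by omega) (by omega) e
        omega
      · intro i hi j hj hij
        simp only [Finset.coe_filter, Finset.mem_range, Set.mem_ofPred_eq] at hi hj
        exact FF_inj w (by omega) (by omega) hij
    omega

def oval (n k i : ℕ) : ℕ :=
  if i + 1 < k then i+1 else if i + 1 = k then 2*n+1-k else if i = k then 0
  else if i < 2*n+1-k then i else if i = 2*n+1-k then 2*n+1
  else if i = 2*n+2-k then k else i-1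

set_option maxHeartbeats 1000000 in
theorem oval_key {n k i j : ℕ} (hk : 1 ≤ k) (hkn : k ≤ n) (hij : i < j) (hj : j < 2*n+2)
    (h : oval n k j < oval n k i) :
    oval n k j = 0 ∨ oval n k i = 2*n+1 ∨ (k ≤ oval n k j ∧ oval n k i ≤ 2*n+1-k) := by
  unfold oval at *
  split_ifs at h ⊢ <;> omega

/-- Let `w ∈ W^{P_k} ∩ W^{odd}` with `w(1) = 1`, corresponding to `λ ∈ Λ` with
`λ_1 = 2n+1-k`, and let `O_1 = (2 < 3 < ⋯ < k < \overline{k+1})` (the minimal length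
representative with these first `k` values).  Then `λ*` exists (i.e. `λ_k ≥ 0`) iff
`w O_1` is a minimal length representative in `W^{odd}`; in that case `w O_1`
corresponds to `λ*`, and in particular `ℓ(w O_1) = ℓ(w) + ℓ(O_1)`. -/
theorem stmt9 (n k : ℕ) (hk : 1 ≤ k) (hkn : k ≤ n)
    (w O1 : Equiv.Perm (Fin (2*n+2)))
    (hw : IsSigned n w) (hwmin : IsMinRep n k w) (hwodd : IsOddSymp n w)
    (hw1 : w ⟨0, by omega⟩ = ⟨0, by omega⟩)
    (hO1s : IsSigned n O1) (hO1min : IsMinRep n k O1)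
    (hO1a : ∀ j : ℕ, ∀ _hj : j + 1 < k, (O1 ⟨j, by omega⟩ : ℕ) = j + 1)
    (hO1b : (O1 ⟨k-1, by omega⟩ : ℕ) = 2*n+1-k) :
    ((0 : ℤ) ≤ partOf n k (by omega) w ⟨k-1, by omega⟩ ↔
      IsMinRep n k (w * O1) ∧ IsOddSymp n (w * O1)) ∧
    ((0 : ℤ) ≤ partOf n k (by omega) w ⟨k-1, by omega⟩ →
      (∀ j : Fin k, partOf n k (by omega) (w * O1) j = starP k (partOf n k (by omega) w) j) ∧
      len n (w * O1) = len n w + len n O1) := by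
  have hO1min' := sorted_of_minRep hk hO1s hO1min
  have hs := sorted_of_minRep hk hw hwmin
  have Oa : ∀ j, j + 1 < k → FF n O1 j = j + 1 := by
    intro j hj
    have := hO1a j hj
    rwa [FF_eq] at this
  have Ob : FF n O1 (k-1) = 2*n+1-k := by rwa [FF_eq] at hO1b
  have w0 : FF n w 0 = 0 := by
    have := congrArg Fin.val hw1
    rwa [FF_eq] at this
  clear hO1a hO1b hw1
  obtain ⟨Oc, Od⟩ := O1_val hk hkn hO1s hO1min' Oa Ob
  have hwO := signed_mul hw hO1s
  have A := mono_of_step (f := FF n w) (a := 0) (b := k-1)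
    (fun i _ _ => hs i (by omega) (by omega))
  have B := mono_mid hkn hw (fun i _ _ => hs i (by omega) (by omega))
  have hak : FF n w k ≤ n := by
    have := B (2*n+1-k) k (by omega) (by omega) (by omega)
    rw [FF_bar hw (by omega)] at this
    omega
  -- values of the product
  have Pa : ∀ j, j + 1 < k → FF n (w * O1) j = FF n w (j+1) := by
    intro j hj; rw [FF_mul _ _ (by omega), Oa j hj]
  have Pb : FF n (w * O1) (k-1) = 2*n+1 - FF n w k := by
    rw [FF_mul _ _ (by omega), Ob, FF_bar hw (by omega)]
  have Pc : FF n (w * O1) k = 0 := by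
    rw [FF_mul _ _ (by omega), Oc, w0]
  have Pd : ∀ j, k < j → j ≤ n → FF n (w * O1) j = FF n w j := by
    intro j h1 h2; rw [FF_mul _ _ (by omega), Od j h1 h2]
  have hodd : IsOddSymp n (w * O1) := by
    intro j hj
    rw [FF_eq]
    intro e
    rcases Nat.lt_trichotomy (j : ℕ) k with h1 | h1 | h1
    · rcases Nat.lt_or_ge ((j : ℕ)+1) k with h2 | h2
      · rw [Pa _ h2] at e
        have := hwodd ⟨(j : ℕ)+1, by omega⟩ (by simp only []; omega)
        rw [FF_eq] at this
        exact this e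
      · rw [show (j : ℕ) = k-1 by omega, Pb] at e
        have := FF_inj w (i := k) (j := 0) (by omega) (by omega) (by omega)
        omega
    · rw [h1, Pc] at e; omega
    · rw [Pd _ h1 (by omega)] at e
      have := hwodd j hj
      rw [FF_eq] at this
      exact this e
  have hsort : Sorted' n k (w * O1) ↔ FF n w (k-1) + FF n w k < 2*n+1 := by
    constructor
    · intro h
      rcases Nat.lt_or_ge 1 k with h1 | h1
      · have := h (k-2) (by omega) (by omega)
        rw [Pa _ (by omega), show k-2+1 = k-1 by omega, Pb] at this
        omega
      · rw [show k-1 = 0 by omega, w0]; omega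
    · intro h i hi hik
      rcases Nat.lt_trichotomy i k with h1 | h1 | h1
      · rw [Pa _ (by omega)]
        rcases Nat.lt_or_ge (i+1+1) k with h2 | h2
        · rw [Pa _ h2]; exact hs _ (by omega) (by omega)
        · rw [show i+1 = k-1 by omega, Pb]; omega
      · subst h1
        rw [Pc]
        by_contra hc
        have := FF_inj (w * O1) (i := i) (j := i+1) (by omega) (by omega) (by omega)
        omega
      · rw [Pd i h1 hi]
        rcases Nat.lt_or_ge i n with h2 | h2
        · rw [Pd _ (by omega) (by omega)]; exact hs _ (by omega) (by omega)
        · have e : i = n := by omega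
          subst e
          have e2 := FF_bar hwO (i := i) (by omega)
          have e3 := FF_bar hw (i := i) (by omega)
          rw [show 2*i+1-i = i+1 by omega] at e2 e3
          rw [e2, Pd i h1 hi, ← e3]
          exact hs _ (by omega) (by omega)
  have hiff := part_iff hk hkn hw hs (by omega) (by omega)
  refine ⟨?_, ?_⟩
  · rw [hiff, ← hsort]
    exact ⟨fun h => ⟨minRep_of_sorted hk hkn hwO h, hodd⟩, fun h => sorted_of_minRep hk hwO h.1⟩
  · intro h0
    rw [hiff] at h0
    refine ⟨?_, ?_⟩
    · intro j
      have hj := j.isLt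
      unfold starP
      split_ifs with hjk
      · rw [partOf_eq, partOf_eq]
        simp only []
        rw [Pa _ hjk, Finset.sum_range_succ', w0, if_neg (by
          have := FF_lt w (i := (j : ℕ)+1) (by omega)
          omega), add_zero]
        congr 2
        apply Finset.sum_congr rfl
        intro i hi
        rw [Finset.mem_range] at hi
        rw [Pa i (by omega)]
      · have ej : (j : ℕ) = k-1 := by omega
        rw [partOf_eq, ej, Pb]
        have hcnt := count_low hk hkn hw hs (FF n w k) le_rfl (by omega)
        have e1 : (∑ i ∈ Finset.range (k-1),
            if 2*n+2 ≤ FF n (w * O1) i + (2*n+1 - FF n w k) then 1 else 0) =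
            ∑ i ∈ Finset.range k, if 2*n+2 ≤ FF n w i + (2*n+1 - FF n w k) then 1 else 0 := by
          rw [show Finset.range k = Finset.range (k-1+1) by congr 1; omega,
            Finset.sum_range_succ', w0, if_neg (by omega), add_zero]
          apply Finset.sum_congr rfl
          intro i hi
          rw [Finset.mem_range] at hi
          rw [Pa i (by omega)]
        have e2 : (∑ i ∈ Finset.range k, if 2*n+2 ≤ FF n w i + (2*n+1 - FF n w k) then 1 else 0) +
            (∑ i ∈ Finset.range k, if FF n w i < FF n w k then 1 else 0) = k := by
          rw [← Finset.sum_add_distrib]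
          rw [Finset.sum_congr rfl (g := fun _ => 1)]
          · simp
          · intro i hi
            rw [Finset.mem_range] at hi
            have : FF n w i ≠ FF n w k := fun e => by
              have := FF_inj w (by omega) (by omega) e
              omega
            split_ifs <;> omega
        rw [e1]
        omega
    · have hM : MM n (w * O1) = MM n w + MM n O1 := by
        apply MM_mul hO1s
        intro i j hij hO
        rw [Fin.lt_def] at hij hO ⊢
        rw [FF_eq, FF_eq] at hO
        rw [FF_eq w, FF_eq w, FF_eq O1, FF_eq O1]
        have val : ∀ i, i < 2*n+2 → FF n O1 i =
            oval n k i := by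
          intro i hi
          have eb := FF_bar hO1s (i := 2*n+1-i) (by omega)
          rw [show 2*n+1-(2*n+1-i) = i by omega] at eb
          unfold oval
          split_ifs with c1 c2 c3 c4 c5 c6
          · exact Oa i c1
          · rw [show i = k-1 by omega]; exact Ob
          · rw [c3]; exact Oc
          · rcases Nat.lt_or_ge n i with h | h
            · rw [Od (2*n+1-i) (by omega) (by omega)] at eb; omega
            · exact Od i (by omega) h
          · rw [show 2*n+1-i = k by omega, Oc] at eb; omega
          · rw [show 2*n+1-i = k-1 by omega, Ob] at eb; omega
          · rw [Oa (2*n+1-i) (by omega)] at eb; omega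
        have hi := i.isLt
        have hj := j.isLt
        have li := FF_lt O1 hi
        have lj := FF_lt O1 hj
        have key : FF n O1 j = 0 ∨ FF n O1 i = 2*n+1 ∨
            (k ≤ FF n O1 j ∧ FF n O1 i ≤ 2*n+1-k) := by
          rw [val i hi, val j hj] at hO ⊢
          exact oval_key hk hkn hij hj hO
        have hne : FF n w (FF n O1 i) ≠ FF n w (FF n O1 j) := fun e => by
          have := FF_inj w li lj e
          omega
        rcases key with h | h | ⟨h, h'⟩
        · rw [h, w0] at hne ⊢; omega
        · have e := FF_bar hw (i := 0) (by omega)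
          rw [w0] at e
          have := FF_lt w lj
          rw [h] at hne ⊢
          simp only [Nat.sub_zero] at e
          omega
        · exact B _ _ h hO h'
      have t1 := two_len hw
      have t2 := two_len hO1s
      have t3 := two_len hwO
      omega
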